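/- arXiv:2204.07277 — 11 statements merged into one kernel-verified Lean document; each statement's English description precedes it below -/
import Mathlib

section
/- For every natural number n ≥ 1 and every real number K > 0, the strict inequality (n + 2K)·((1 + n/K)^{2/n} − 1) > 4 holds. -/
/-- For every `n ≥ 1` and real `K > 0`, `(n + 2K)·((1 + n/K)^{2/n} − 1) > 4`. -/
theorem stmt2 (n : ℕ) (hn : 1 ≤ n) (K : ℝ) (hK : 0 < K) :
    ((n : ℝ) + 2 * K) * ((1 + (n : ℝ) / K) ^ ((2 : ℝ) / n) - 1) > 4 := by
  have hn' : (0 : ℝ) < n := by exact_mod_cast hn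
  have hx : 0 < (n : ℝ) / K := div_pos hn' hK
  have hs : 0 < (n : ℝ) + 2 * K := by positivity
  have hlog := mul_lt_mul_of_pos_right (Real.lt_log_one_add_of_pos hx)
    (div_pos two_pos hn' : (0 : ℝ) < 2 / n)
  have heq : 2 * ((n : ℝ) / K) / ((n : ℝ) / K + 2) * (2 / n) = 4 / ((n : ℝ) + 2 * K) := by
    field_simp
    ring
  have hexp := Real.add_one_le_exp (Real.log (1 + (n : ℝ) / K) * (2 / n))
  rw [← Real.rpow_def_of_pos (by positivity)] at hexp
  rw [heq] at hlog
  exact (div_lt_iff₀' hs).mp (by linarith)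
end

section
/- For every integer n ≥ 3, the strict inequality (n!)^{2/n}·((n+1)^{2/n} − 1) > n + 2 holds, while for n = 1 and n = 2 the two sides are equal. -/
/-- A rational lower bound for `m ^ (2 / n)`, checked on natural numbers. -/
lemma natCast_div_le_rpow_two_div {n d p m : ℕ} (hn : n ≠ 0) (hd : d ≠ 0)
    (h : p ^ n ≤ m ^ 2 * d ^ n) :
    (p : ℝ) / d ≤ (m : ℝ) ^ ((2 : ℝ) / n) := by
  have hd' : (0 : ℝ) < d := by positivity
  have h' : ((p : ℝ) / d) ^ n ≤ (m : ℝ) ^ 2 := by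
    rw [div_pow, div_le_iff₀ (by positivity)]
    exact_mod_cast h
  have hm : ((m : ℝ) ^ ((2 : ℝ) / n)) ^ n = (m : ℝ) ^ 2 := by
    rw [← Real.rpow_natCast, ← Real.rpow_mul (by positivity),
      div_mul_cancel₀ _ (by positivity), Real.rpow_two]
  rw [← hm] at h'
  exact le_of_pow_le_pow_left₀ hn (by positivity) h'

/-- The inequality for `n` follows from rational lower bounds `p / d` and `q / d` of the two
powers. -/
lemma lt_factorial_rpow_mul_of_nat_bounds {n : ℕ} (d p q : ℕ) (hn : n ≠ 0) (hd : d ≠ 0)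
    (hp : p ^ n ≤ n.factorial ^ 2 * d ^ n) (hq : q ^ n ≤ (n + 1) ^ 2 * d ^ n)
    (h : (n + 2) * d ^ 2 + p * d < p * q) :
    (n : ℝ) + 2 <
      (n.factorial : ℝ) ^ ((2 : ℝ) / n) * (((n : ℝ) + 1) ^ ((2 : ℝ) / n) - 1) := by
  have hd' : (0 : ℝ) < d := by positivity
  have h1 := natCast_div_le_rpow_two_div hn hd hp
  have h2 := natCast_div_le_rpow_two_div hn hd hq
  push_cast at h2
  have h3 : ((n : ℝ) + 2) * d ^ 2 + p * d < p * q := by exact_mod_cast h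
  have h4 : (n : ℝ) + 2 < (p : ℝ) / d * ((q : ℝ) / d - 1) := by
    have : (p : ℝ) / d * ((q : ℝ) / d - 1) = (p * q - p * d) / d ^ 2 := by
      field_simp
    rw [this, lt_div_iff₀ (by positivity)]
    linarith
  have h5 : 0 ≤ (n.factorial : ℝ) ^ ((2 : ℝ) / n) := by positivity
  have h6 : 0 ≤ (q : ℝ) / d - 1 := by
    by_contra! hneg
    have : (p : ℝ) / d * ((q : ℝ) / d - 1) ≤ 0 :=
      mul_nonpos_of_nonneg_of_nonpos (by positivity) hneg.le
    have : (0 : ℝ) ≤ n := by positivity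
    linarith
  exact h4.trans_le (mul_le_mul h1 (by linarith) h6 h5)

lemma div_exp_one_sq_le_factorial_rpow {n : ℕ} (hn : n ≠ 0) :
    ((n : ℝ) / Real.exp 1) ^ 2 ≤ (n.factorial : ℝ) ^ ((2 : ℝ) / n) := by
  have h : ((n : ℝ) / Real.exp 1) ^ n ≤ n.factorial := by
    have := Real.pow_div_factorial_le_exp (n : ℝ) (by positivity) n
    rw [div_le_iff₀ (by positivity)] at this
    rw [div_pow, ← Real.exp_nat_mul, mul_one, div_le_iff₀ (by positivity)]
    linarith
  calc ((n : ℝ) / Real.exp 1) ^ 2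
      = (((n : ℝ) / Real.exp 1) ^ n) ^ ((2 : ℝ) / n) := by
        rw [← Real.rpow_natCast _ n, ← Real.rpow_mul (by positivity),
          mul_div_cancel₀ _ (by positivity), Real.rpow_two]
    _ ≤ _ := Real.rpow_le_rpow (by positivity) h (by positivity)

lemma log_41_ge : 3.7 ≤ Real.log 41 := by
  have h : Real.exp 37 ≤ (41 : ℝ) ^ 10 := by
    calc Real.exp 37 = Real.exp 1 ^ 37 := by rw [← Real.exp_nat_mul]; norm_num
      _ ≤ 2.7182818286 ^ 37 :=
        pow_le_pow_left₀ (Real.exp_pos 1).le Real.exp_one_lt_d9.le 37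
      _ ≤ (41 : ℝ) ^ 10 := by norm_num
  have := (Real.le_log_iff_exp_le (by positivity)).2 h
  rw [Real.log_pow] at this
  norm_num at this ⊢
  linarith

lemma lt_factorial_rpow_mul_of_forty_le {n : ℕ} (hn : 40 ≤ n) :
    (n : ℝ) + 2 <
      (n.factorial : ℝ) ^ ((2 : ℝ) / n) * (((n : ℝ) + 1) ^ ((2 : ℝ) / n) - 1) := by
  have hn' : (40 : ℝ) ≤ n := by exact_mod_cast hn
  have hpos : (0 : ℝ) < n := by linarith
  set l := Real.log ((n : ℝ) + 1) with hl
  have hl1 : 3.7 ≤ l :=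
    log_41_ge.trans (Real.log_le_log (by norm_num) (by linarith))
  have hl0 : 0 < l := by linarith
  have h1 := div_exp_one_sq_le_factorial_rpow (n := n) (by omega)
  have h2 : 2 * l / n + 2 * l ^ 2 / n ^ 2 ≤ ((n : ℝ) + 1) ^ ((2 : ℝ) / n) - 1 := by
    rw [Real.rpow_def_of_pos (by linarith), ← hl]
    have := Real.quadratic_le_exp_of_nonneg (x := l * (2 / n)) (by positivity)
    have e : 1 + l * (2 / n) + (l * (2 / n)) ^ 2 / 2
        = 1 + (2 * l / n + 2 * l ^ 2 / n ^ 2) := by ring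
    linarith
  have he : Real.exp 1 ^ 2 ≤ 2 * l := by
    have := Real.exp_one_lt_d9
    have := Real.exp_pos 1
    nlinarith
  calc (n : ℝ) + 2 < n + l := by linarith
    _ ≤ 2 * l / Real.exp 1 ^ 2 * (n + l) :=
        le_mul_of_one_le_left (by positivity) ((one_le_div (by positivity)).2 he)
    _ = ((n : ℝ) / Real.exp 1) ^ 2 * (2 * l / n + 2 * l ^ 2 / n ^ 2) := by
        field_simp
    _ ≤ _ := mul_le_mul h1 h2 (by positivity) (by positivity)

lemma lt_factorial_rpow_mul_of_lt_forty {n : ℕ} (h3 : 3 ≤ n) (hn : n < 40) :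
    (n : ℝ) + 2 <
      (n.factorial : ℝ) ^ ((2 : ℝ) / n) * (((n : ℝ) + 1) ^ ((2 : ℝ) / n) - 1) := by
  obtain ⟨d, p, q, hd, hp, hq, h⟩ : ∃ d p q : ℕ, d ≠ 0 ∧
      p ^ n ≤ n.factorial ^ 2 * d ^ n ∧ q ^ n ≤ (n + 1) ^ 2 * d ^ n ∧
      (n + 2) * d ^ 2 + p * d < p * q := by
    interval_cases n
    · exact ⟨1000, 3301, 2519, by norm_num [Nat.factorial]⟩
    · exact ⟨100, 489, 223, by norm_num [Nat.factorial]⟩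
    · exact ⟨100, 678, 204, by norm_num [Nat.factorial]⟩
    · exact ⟨10, 89, 19, by norm_num [Nat.factorial]⟩
    · exact ⟨10, 114, 18, by norm_num [Nat.factorial]⟩
    · exact ⟨100, 1417, 173, by norm_num [Nat.factorial]⟩
    · exact ⟨100, 1719, 166, by norm_num [Nat.factorial]⟩
    · exact ⟨10, 205, 16, by norm_num [Nat.factorial]⟩
    · exact ⟨100, 2410, 157, by norm_num [Nat.factorial]⟩
    · exact ⟨100, 2797, 153, by norm_num [Nat.factorial]⟩
    · exact ⟨10, 321, 15, by norm_num [Nat.factorial]⟩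
    · exact ⟨100, 3655, 147, by norm_num [Nat.factorial]⟩
    · exact ⟨100, 4126, 144, by norm_num [Nat.factorial]⟩
    · exact ⟨10, 462, 14, by norm_num [Nat.factorial]⟩
    · exact ⟨10, 515, 14, by norm_num [Nat.factorial]⟩
    · exact ⟨100, 5705, 138, by norm_num [Nat.factorial]⟩
    · exact ⟨100, 6286, 137, by norm_num [Nat.factorial]⟩
    · exact ⟨100, 6896, 135, by norm_num [Nat.factorial]⟩
    · exact ⟨100, 7533, 134, by norm_num [Nat.factorial]⟩
    · exact ⟨10, 819, 13, by norm_num [Nat.factorial]⟩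
    · exact ⟨10, 889, 13, by norm_num [Nat.factorial]⟩
    · exact ⟨10, 961, 13, by norm_num [Nat.factorial]⟩
    · exact ⟨100, 10357, 129, by norm_num [Nat.factorial]⟩
    · exact ⟨100, 11132, 128, by norm_num [Nat.factorial]⟩
    · exact ⟨100, 11934, 127, by norm_num [Nat.factorial]⟩
    · exact ⟨100, 12764, 127, by norm_num [Nat.factorial]⟩
    · exact ⟨100, 13622, 126, by norm_num [Nat.factorial]⟩
    · exact ⟨100, 14506, 125, by norm_num [Nat.factorial]⟩
    · exact ⟨100, 15419, 125, by norm_num [Nat.factorial]⟩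
    · exact ⟨100, 16359, 124, by norm_num [Nat.factorial]⟩
    · exact ⟨100, 17326, 123, by norm_num [Nat.factorial]⟩
    · exact ⟨10, 1832, 12, by norm_num [Nat.factorial]⟩
    · exact ⟨10, 1934, 12, by norm_num [Nat.factorial]⟩
    · exact ⟨10, 2039, 12, by norm_num [Nat.factorial]⟩
    · exact ⟨10, 2146, 12, by norm_num [Nat.factorial]⟩
    · exact ⟨10, 2257, 12, by norm_num [Nat.factorial]⟩
    · exact ⟨10, 2370, 12, by norm_num [Nat.factorial]⟩
  exact lt_factorial_rpow_mul_of_nat_bounds d p q (by omega) hd hp hq h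

/-- For `n ≥ 3`, `(n!)^{2/n}·((n+1)^{2/n} − 1) > n + 2`, with equality for `n = 1, 2`. -/
theorem stmt3 (n : ℕ) :
    (3 ≤ n →
      (n.factorial : ℝ) ^ ((2 : ℝ) / n) * (((n : ℝ) + 1) ^ ((2 : ℝ) / n) - 1)
        > (n : ℝ) + 2) ∧
    ((n = 1 ∨ n = 2) →
      (n.factorial : ℝ) ^ ((2 : ℝ) / n) * (((n : ℝ) + 1) ^ ((2 : ℝ) / n) - 1)
        = (n : ℝ) + 2) := by
  refine ⟨fun h3 => ?_, ?_⟩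
  · rcases lt_or_ge n 40 with hn | hn
    · exact lt_factorial_rpow_mul_of_lt_forty h3 hn
    · exact lt_factorial_rpow_mul_of_forty_le hn
  · rintro (rfl | rfl) <;> norm_num [Nat.factorial]
end

section
/- Let n ≥ 2 be an integer and define Φ(K) = (K(K+1)(K+2)⋯(K+n-1))^{2/n} − K(K+n-1) for positive integers K. Then Φ(K) converges to (n−1)(n−2)/6 as K → ∞. -/
open Filter Topology in
/-- The difference between the geometric mean of the numbers `x + c i` and `x` tends to the
arithmetic mean of the `c i` as `x → ∞`. -/
theorem tendsto_geom_mean_add_sub_atTop {ι : Type*} (s : Finset ι) (hs : s.Nonempty)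
    (c : ι → ℝ) :
    Tendsto (fun x : ℝ => (∏ i ∈ s, (x + c i)) ^ ((1 : ℝ) / s.card) - x) atTop
      (𝓝 ((∑ i ∈ s, c i) / s.card)) := by
  classical
  have hcard : (s.card : ℝ) ≠ 0 := by exact_mod_cast hs.card_ne_zero
  have hprod : HasDerivAt (fun t : ℝ => ∏ i ∈ s, (1 + c i * t)) (∑ i ∈ s, c i) 0 := by
    have h := HasDerivAt.fun_finsetProd (u := s) (f := fun i (t : ℝ) => 1 + c i * t)
      (f' := c) (x := 0)
      (fun i _ => by simpa using ((hasDerivAt_id (0 : ℝ)).const_mul (c i)).const_add 1)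
    simpa using h
  have hroot : HasDerivAt (fun t : ℝ => (∏ i ∈ s, (1 + c i * t)) ^ ((1 : ℝ) / s.card))
      ((∑ i ∈ s, c i) / s.card) 0 := by
    have h := hprod.rpow_const (p := (1 : ℝ) / s.card) (Or.inl (by simp))
    simpa [div_eq_mul_inv] using h
  have hinv : Tendsto (fun x : ℝ => x⁻¹) atTop (𝓝[≠] 0) :=
    tendsto_inv_atTop_nhdsGT_zero.mono_right (nhdsWithin_mono _ fun _ hx => ne_of_gt hx)
  refine ((hasDerivAt_iff_tendsto_slope.1 hroot).comp hinv).congr' ?_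
  have hpos : ∀ᶠ x : ℝ in atTop, ∀ i ∈ s, 0 < x + c i :=
    (eventually_all_finset s).2 fun i _ =>
      (tendsto_atTop_add_const_right _ (c i) tendsto_id).eventually_gt_atTop 0
  filter_upwards [hpos, eventually_gt_atTop 0] with x hx hx0
  have hfac : ∏ i ∈ s, (x + c i) = x ^ s.card * ∏ i ∈ s, (1 + c i * x⁻¹) := by
    rw [← Finset.prod_const, ← Finset.prod_mul_distrib]
    refine Finset.prod_congr rfl fun i _ => ?_
    field_simp
  have hnonneg : 0 ≤ ∏ i ∈ s, (1 + c i * x⁻¹) := by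
    refine Finset.prod_nonneg fun i hi => ?_
    have : 1 + c i * x⁻¹ = (x + c i) * x⁻¹ := by field_simp
    rw [this]
    exact (mul_pos (hx i hi) (inv_pos.2 hx0)).le
  have hpow : (x ^ s.card) ^ ((1 : ℝ) / s.card) = x := by
    rw [one_div]
    exact Real.pow_rpow_inv_natCast hx0.le hs.card_ne_zero
  rw [hfac, Real.mul_rpow (by positivity) hnonneg, hpow]
  simp [slope_def_field]
  field_simp

/-- Pairing the factors `x + i` and `x + (n - 1 - i)` in the square of a rising factorial. -/
theorem sq_prod_range_add (n : ℕ) (x : ℝ) :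
    (∏ i ∈ Finset.range n, (x + i)) ^ 2
      = ∏ i ∈ Finset.range n, (x * (x + n - 1) + (i : ℝ) * (n - 1 - i)) := by
  rw [sq]
  nth_rewrite 2 [← Finset.prod_range_reflect]
  rw [← Finset.prod_mul_distrib]
  refine Finset.prod_congr rfl fun i hi => ?_
  have hi' := Finset.mem_range.1 hi
  rw [Nat.sub_sub, Nat.cast_sub (by omega)]
  push_cast
  ring

theorem sum_range_mul_reflect (n : ℕ) :
    ∑ i ∈ Finset.range n, (i : ℝ) * (n - 1 - i) = n * ((n - 1) * (n - 2) / 6) := by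
  have key (m : ℕ) (a : ℝ) : ∑ i ∈ Finset.range m, (i : ℝ) * (a - i)
      = a * (m * (m - 1) / 2) - m * (m - 1) * (2 * m - 1) / 6 := by
    induction m with
    | zero => simp
    | succ m ih =>
      rw [Finset.sum_range_succ, ih]
      push_cast
      ring
  rw [key]
  ring

/-- For `n ≥ 2`, `Φ(K) = (K^{\overline{n}})^{2/n} − K(K+n-1)` converges to
`(n−1)(n−2)/6` as `K → ∞`. -/
theorem stmt5 (n : ℕ) (hn : 2 ≤ n) :
    Filter.Tendsto
      (fun K : ℕ =>
        (∏ i ∈ Finset.range n, ((K : ℝ) + i)) ^ ((2 : ℝ) / n)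
          - (K : ℝ) * ((K : ℝ) + n - 1))
      Filter.atTop (nhds (((n : ℝ) - 1) * ((n : ℝ) - 2) / 6)) := by
  have hn0 : (n : ℝ) ≠ 0 := by positivity
  have hA : Filter.Tendsto (fun K : ℕ => (K : ℝ) * ((K : ℝ) + n - 1)) Filter.atTop
      Filter.atTop := by
    refine tendsto_natCast_atTop_atTop.atTop_mul_atTop₀ ?_
    simp only [add_sub_assoc]
    exact Filter.tendsto_atTop_add_const_right _ _ tendsto_natCast_atTop_atTop
  have h := (tendsto_geom_mean_add_sub_atTop (Finset.range n)
    (Finset.nonempty_range_iff.2 (by omega)) fun i => (i : ℝ) * (n - 1 - i)).comp hA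
  rw [sum_range_mul_reflect, Finset.card_range, mul_div_cancel_left₀ _ hn0] at h
  refine h.congr fun K => ?_
  have hP : 0 ≤ ∏ i ∈ Finset.range n, ((K : ℝ) + i) :=
    Finset.prod_nonneg fun i _ => by positivity
  rw [Function.comp_apply, ← sq_prod_range_add, ← Real.rpow_natCast, ← Real.rpow_mul hP]
  congr 2
  push_cast
  ring
end

section
/- For every integer n with 2 ≤ n ≤ 8 and every integer K ≥ 2, one has (K(K+n-1))^n ≥ ((K−1)K(K+1)⋯(K+n-2) + n!)^2. (This is Pólya's inequality for the lowest-order Dirichlet eigenvalue of the K-chain on the hemisphere S^n_+.) -/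
/-- Pólya's inequality for the lowest-order Dirichlet eigenvalue of the `K`-chain on
`S^n_+` for `2 ≤ n ≤ 8` and `K ≥ 2`: `(K(K+n-1))^n ≥ ((K−1)^{\overline{n}} + n!)^2`. -/
theorem stmt7 (n : ℕ) (hn2 : 2 ≤ n) (hn8 : n ≤ 8) (K : ℕ) (hK : 2 ≤ K) :
    ((∏ i ∈ Finset.range n, (K - 1 + i)) + n.factorial) ^ 2
      ≤ (K * (K + n - 1)) ^ n := by
  obtain ⟨m, rfl⟩ := Nat.exists_eq_add_of_le' hK
  have hsub (j : ℕ) : m + 2 + (j + 1) - 1 = m + 2 + j := by omega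
  interval_cases n <;>
  · simp only [Finset.prod_range_succ, Finset.prod_range_zero, Nat.factorial,
      hsub, show m + 2 - 1 = m + 1 from rfl]
    rw [← Nat.cast_le (α := ℤ), ← sub_nonneg]
    push_cast
    ring_nf
    positivity
end

section
/- For every integer n ≥ 2, the inequality (2·n!)^2 ≤ 2^n·(n+1)^n holds if and only if n ≤ 8. (Equivalently, the lowest-order Dirichlet eigenvalue of the 2-chain on the hemisphere S^n_+ satisfies Pólya's inequality if and only if n ≤ 8.) -/
theorem two_mul_succ_pow_le_pow_succ {m : ℕ} (hm : 6 ≤ m) :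
    2 * (m + 1) ^ m ≤ m ^ (m + 1) := by
  induction m, hm using Nat.le_induction with
  | base => norm_num
  | succ m hm ih =>
    have hpos : 0 < m ^ (m + 1) := by positivity
    have hsq : (m + 2) ^ (m + 1) * m ^ (m + 1) ≤ (m + 1) ^ m * (m + 1) ^ (m + 2) := by
      calc (m + 2) ^ (m + 1) * m ^ (m + 1) = ((m + 2) * m) ^ (m + 1) := (mul_pow _ _ _).symm
        _ ≤ ((m + 1) ^ 2) ^ (m + 1) := Nat.pow_le_pow_left (by nlinarith) _
        _ = (m + 1) ^ m * (m + 1) ^ (m + 2) := by rw [← pow_mul]; ring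
    refine le_of_mul_le_mul_right ?_ hpos
    calc 2 * (m + 2) ^ (m + 1) * m ^ (m + 1)
        = 2 * ((m + 2) ^ (m + 1) * m ^ (m + 1)) := by ring
      _ ≤ 2 * ((m + 1) ^ m * (m + 1) ^ (m + 2)) := Nat.mul_le_mul_left _ hsq
      _ = 2 * (m + 1) ^ m * (m + 1) ^ (m + 2) := by ring
      _ ≤ m ^ (m + 1) * (m + 1) ^ (m + 2) := Nat.mul_le_mul_right _ ih
      _ = (m + 1) ^ (m + 2) * m ^ (m + 1) := mul_comm _ _

theorem two_pow_mul_succ_pow_lt_sq_two_mul_factorial {n : ℕ} (hn : 9 ≤ n) :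
    2 ^ n * (n + 1) ^ n < (2 * n.factorial) ^ 2 := by
  induction n, hn using Nat.le_induction with
  | base => norm_num [Nat.factorial]
  | succ n hn ih =>
    calc 2 ^ (n + 1) * (n + 1 + 1) ^ (n + 1)
        = 2 ^ n * (2 * (n + 1 + 1) ^ (n + 1)) := by ring
      _ ≤ 2 ^ n * (n + 1) ^ (n + 1 + 1) :=
        Nat.mul_le_mul_left _ (two_mul_succ_pow_le_pow_succ (by omega))
      _ = (n + 1) ^ 2 * (2 ^ n * (n + 1) ^ n) := by ring
      _ < (n + 1) ^ 2 * (2 * n.factorial) ^ 2 := Nat.mul_lt_mul_of_pos_left ih (by positivity)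
      _ = (2 * (n + 1).factorial) ^ 2 := by rw [Nat.factorial_succ]; ring

/-- For `n ≥ 2`, the inequality `(2·n!)^2 ≤ 2^n·(n+1)^n` holds iff `n ≤ 8`
(Pólya's inequality for the lowest-order eigenvalue of the `2`-chain on `S^n_+`). -/
theorem stmt9 (n : ℕ) (hn : 2 ≤ n) :
    (2 * n.factorial) ^ 2 ≤ 2 ^ n * (n + 1) ^ n ↔ n ≤ 8 := by
  constructor
  · intro h
    by_contra! hlt
    exact (two_pow_mul_succ_pow_lt_sq_two_mul_factorial hlt).not_ge h
  · intro h
    interval_cases n <;> norm_num [Nat.factorial]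
end

section
/- Let n ∈ {2, 5, 6}. For every integer K ≥ 1, setting U = (K−1)K(K+1)⋯(K+n-2) + n!, one has K(K+n-1) ≤ U^{2/n} + 2·U^{1/n}. Consequently, for every k ≥ 1, the k-th Dirichlet eigenvalue λ_k of the hemisphere S^n_+ satisfies λ_k ≤ (n!)^{2/n}·k^{2/n} + 2·(n!)^{1/n}·k^{1/n}. -/
theorem le_rpow_two_div_add_of_pow_le {n : ℕ} (hn : n ≠ 0) {L t V : ℝ} (ht : 0 ≤ t)
    (hV : t ^ n ≤ V) (hL : L ≤ t ^ 2 + 2 * t) :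
    L ≤ V ^ ((2 : ℝ) / n) + 2 * V ^ ((1 : ℝ) / n) := by
  have hV0 : 0 ≤ V := (pow_nonneg ht n).trans hV
  have htV : t ≤ V ^ ((1 : ℝ) / n) := by
    rw [one_div, Real.le_rpow_inv_iff_of_pos ht hV0 (by positivity), Real.rpow_natCast]
    exact hV
  have hsq : V ^ ((2 : ℝ) / n) = (V ^ ((1 : ℝ) / n)) ^ 2 := by
    rw [← Real.rpow_natCast, ← Real.rpow_mul hV0]
    congr 1
    push_cast
    ring
  rw [hsq]
  have := pow_le_pow_left₀ ht htV 2
  linarith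

/-- The rational majorant `t` of `√(K(K+n-1)+1) - 1` satisfies `t ^ n ≤ U`. -/
theorem exists_pow_le_prod_add_factorial {n : ℕ} (hn : n = 2 ∨ n = 5 ∨ n = 6) {K : ℕ}
    (hK : 1 ≤ K) :
    ∃ t : ℝ, 0 ≤ t ∧
      t ^ n ≤ (∏ i ∈ Finset.range n, ((K : ℝ) - 1 + i)) + n.factorial ∧
      (K : ℝ) * ((K : ℝ) + n - 1) ≤ t ^ 2 + 2 * t := by
  obtain ⟨j, rfl⟩ := Nat.exists_eq_add_of_le' hK
  have hj : (0 : ℝ) ≤ j := j.cast_nonneg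
  rw [Nat.cast_add_one]
  generalize (j : ℝ) = x at hj ⊢
  rcases hn with rfl | rfl | rfl
  · refine ⟨(8 * x ^ 2 + 16 * x + 9) / (8 * x + 12), by positivity, ?_, ?_⟩
    · rw [div_pow, div_le_iff₀ (by positivity), ← sub_nonneg]
      simp only [Finset.prod_range_succ, Finset.prod_range_zero, Nat.factorial]
      push_cast
      ring_nf
      positivity
    · have hd : (8 * x + 12) ≠ 0 := by positivity
      rw [← sub_nonneg]
      refine le_of_le_of_eq (b := 9 / (8 * x + 12) ^ 2)
        (by positivity) ?_
      push_cast
      field_simp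
      ring
  · refine ⟨(2 * x ^ 2 + 10 * x + 9) / (2 * x + 6), by positivity, ?_, ?_⟩
    · rw [div_pow, div_le_iff₀ (by positivity), ← sub_nonneg]
      simp only [Finset.prod_range_succ, Finset.prod_range_zero, Nat.factorial]
      push_cast
      ring_nf
      positivity
    · have hd : (2 * x + 6) ≠ 0 := by positivity
      rw [← sub_nonneg]
      refine le_of_le_of_eq (b := 9 / (2 * x + 6) ^ 2)
        (by positivity) ?_
      push_cast
      field_simp
      ring
  · refine ⟨(8 * x ^ 2 + 48 * x + 49) / (8 * x + 28), by positivity, ?_, ?_⟩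
    · rw [div_pow, div_le_iff₀ (by positivity), ← sub_nonneg]
      simp only [Finset.prod_range_succ, Finset.prod_range_zero, Nat.factorial]
      push_cast
      ring_nf
      positivity
    · have hd : (8 * x + 28) ≠ 0 := by positivity
      rw [← sub_nonneg]
      refine le_of_le_of_eq (b := 441 / (8 * x + 28) ^ 2)
        (by positivity) ?_
      push_cast
      field_simp
      ring

theorem prod_add_factorial_le_of_lt {n a k : ℕ}
    (h : ∏ i ∈ Finset.range n, (a + i) < n.factorial * k) :
    (∏ i ∈ Finset.range n, (a + i)) + n.factorial ≤ n.factorial * k := by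
  rw [← Nat.ascFactorial_eq_prod_range] at h ⊢
  obtain ⟨c, hc⟩ := Nat.factorial_dvd_ascFactorial a n
  rw [hc] at h ⊢
  rw [← Nat.mul_succ]
  exact Nat.mul_le_mul_left _ (Nat.lt_of_mul_lt_mul_left h)


/-- Two-term upper bound for the Dirichlet eigenvalues of `S^n_+` for `n ∈ {2,5,6}`:
with `U = (K−1)^{\overline{n}} + n!`, one has `K(K+n-1) ≤ U^{2/n} + 2U^{1/n}` for all
`K ≥ 1`; consequently every eigenvalue `λ_k = K(K+n-1)` (with
`(K−1)^{\overline{n}} < n!·k ≤ K^{\overline{n}}`) satisfies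
`λ_k ≤ (n!)^{2/n} k^{2/n} + 2 (n!)^{1/n} k^{1/n}`. -/
theorem stmt10 (n : ℕ) (hn : n = 2 ∨ n = 5 ∨ n = 6) :
    (∀ K : ℕ, 1 ≤ K →
      (K : ℝ) * ((K : ℝ) + n - 1) ≤
        ((∏ i ∈ Finset.range n, ((K : ℝ) - 1 + i)) + n.factorial) ^ ((2 : ℝ) / n)
          + 2 * ((∏ i ∈ Finset.range n, ((K : ℝ) - 1 + i)) + n.factorial)
              ^ ((1 : ℝ) / n)) ∧
    (∀ K k : ℕ, 1 ≤ K → 1 ≤ k →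
      (∏ i ∈ Finset.range n, (K - 1 + i)) < n.factorial * k →
      n.factorial * k ≤ ∏ i ∈ Finset.range n, (K + i) →
      (K : ℝ) * ((K : ℝ) + n - 1) ≤
        (n.factorial : ℝ) ^ ((2 : ℝ) / n) * (k : ℝ) ^ ((2 : ℝ) / n)
          + 2 * (n.factorial : ℝ) ^ ((1 : ℝ) / n) * (k : ℝ) ^ ((1 : ℝ) / n)) := by
  have hn0 : n ≠ 0 := by omega
  refine ⟨fun K hK => ?_, fun K k hK _ hlt _ => ?_⟩
  · obtain ⟨t, ht, htU, hL⟩ := exists_pow_le_prod_add_factorial hn hK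
    exact le_rpow_two_div_add_of_pow_le hn0 ht htU hL
  · obtain ⟨t, ht, htU, hL⟩ := exists_pow_le_prod_add_factorial hn hK
    have hU : (∏ i ∈ Finset.range n, ((K : ℝ) - 1 + i)) + n.factorial ≤ n.factorial * k := by
      have h := prod_add_factorial_le_of_lt hlt
      rify [hK] at h
      exact h
    have h := le_rpow_two_div_add_of_pow_le hn0 ht (htU.trans hU) hL
    rwa [Real.mul_rpow (by positivity) (by positivity),
      Real.mul_rpow (by positivity) (by positivity), ← mul_assoc] at h
end

section
/- For every integer n ≥ 2, the quantity Θ_n(K) = (K(K+n-1) − ((K−1)K(K+1)⋯(K+n-2) + n!)^{2/n}) / ((K−1)K(K+1)⋯(K+n-2) + n!)^{1/n} converges to 2 as the integer K → ∞. -/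
open Filter Topology Finset

/-- `K ^ (-n) * ((K - 1) K ⋯ (K + n - 2) + n!)`, as a polynomial in `x = 1 / K`. -/
noncomputable def scaledRising (n : ℕ) (x : ℝ) : ℝ :=
  (∏ i ∈ range n, (1 + ((i : ℝ) - 1) * x)) + n.factorial * x ^ n

theorem sum_range_cast_sub_one (n : ℕ) :
    ∑ i ∈ range n, ((i : ℝ) - 1) = n * ((n : ℝ) - 3) / 2 := by
  induction n with
  | zero => simp
  | succ k ih =>
    rw [sum_range_succ, ih]
    push_cast
    ring

theorem scaledRising_zero {n : ℕ} (hn : n ≠ 0) : scaledRising n 0 = 1 := by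
  simp [scaledRising, hn]

theorem hasDerivAt_scaledRising {n : ℕ} (hn : 2 ≤ n) :
    HasDerivAt (scaledRising n) (n * ((n : ℝ) - 3) / 2) 0 := by
  have hlin (i : ℕ) : HasDerivAt (fun x : ℝ => 1 + ((i : ℝ) - 1) * x) ((i : ℝ) - 1) 0 := by
    simpa using ((hasDerivAt_id (0 : ℝ)).const_mul ((i : ℝ) - 1)).const_add 1
  have hprod := HasDerivAt.fun_finsetProd (u := range n) fun i _ => hlin i
  have hpow := (hasDerivAt_pow n (0 : ℝ)).const_mul (n.factorial : ℝ)
  have : n - 1 ≠ 0 := by omega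
  refine (hprod.add hpow).congr_deriv ?_
  simp [this, ← sum_range_cast_sub_one]

theorem prod_add_factorial_eq (n : ℕ) {y : ℝ} (hy : y ≠ 0) :
    (∏ i ∈ range n, (y - 1 + i)) + n.factorial = y ^ n * scaledRising n y⁻¹ := by
  have hfac (i : ℕ) : y - 1 + i = y * (1 + ((i : ℝ) - 1) * y⁻¹) := by
    field_simp
    ring
  simp_rw [hfac, prod_mul_distrib, scaledRising, mul_add]
  rw [prod_const, card_range, mul_left_comm, ← mul_pow, mul_inv_cancel₀ hy, one_pow, mul_one]

theorem scaledRising_inv_nonneg (n : ℕ) {y : ℝ} (hy : 1 ≤ y) : 0 ≤ scaledRising n y⁻¹ := by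
  have hpos : 0 < y ^ n := by positivity
  refine nonneg_of_mul_nonneg_right ?_ hpos
  rw [← prod_add_factorial_eq n (by positivity)]
  have : 0 ≤ ∏ i ∈ range n, (y - 1 + i) :=
    prod_nonneg fun i _ => add_nonneg (by linarith) i.cast_nonneg
  positivity

theorem prod_add_factorial_rpow {n : ℕ} (hn : n ≠ 0) {y : ℝ} (hy : 1 ≤ y) (k : ℕ) :
    ((∏ i ∈ range n, (y - 1 + i)) + n.factorial) ^ ((k : ℝ) / n)
      = y ^ k * scaledRising n y⁻¹ ^ ((k : ℝ) / n) := by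
  have hy0 : 0 ≤ y := by linarith
  have hn' : (n : ℝ) ≠ 0 := by exact_mod_cast hn
  rw [prod_add_factorial_eq n (by positivity),
    Real.mul_rpow (by positivity) (scaledRising_inv_nonneg n hy), ← Real.rpow_natCast y n,
    ← Real.rpow_mul hy0, mul_div_cancel₀ _ hn', Real.rpow_natCast]

/-- For `n ≥ 2`, the normalized gap
`Θ_n(K) = (K(K+n-1) − ((K−1)^{\overline{n}} + n!)^{2/n}) / ((K−1)^{\overline{n}} + n!)^{1/n}`
tends to `2` as the integer `K → ∞`. -/
theorem stmt11 (n : ℕ) (hn : 2 ≤ n) :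
    Filter.Tendsto
      (fun K : ℕ =>
        ((K : ℝ) * ((K : ℝ) + n - 1)
            - ((∏ i ∈ Finset.range n, ((K : ℝ) - 1 + i)) + n.factorial)
                ^ ((2 : ℝ) / n))
          / ((∏ i ∈ Finset.range n, ((K : ℝ) - 1 + i)) + n.factorial)
              ^ ((1 : ℝ) / n))
      Filter.atTop (nhds 2) := by
  have hn0 : n ≠ 0 := by omega
  have hn' : (n : ℝ) ≠ 0 := by exact_mod_cast hn0
  have hf := hasDerivAt_scaledRising hn
  have hf0 := scaledRising_zero hn0
  have hgap : HasDerivAt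
      (fun x : ℝ => 1 + ((n : ℝ) - 1) * x - scaledRising n x ^ ((2 : ℝ) / n)) 2 0 := by
    have hlin : HasDerivAt (fun x : ℝ => 1 + ((n : ℝ) - 1) * x) ((n : ℝ) - 1) 0 := by
      simpa using ((hasDerivAt_id (0 : ℝ)).const_mul ((n : ℝ) - 1)).const_add 1
    refine (hlin.sub
      (hf.rpow_const (p := (2 : ℝ) / n) (Or.inl (by simp [hf0])))).congr_deriv ?_
    rw [hf0, Real.one_rpow]
    field_simp
    ring
  have hroot : Tendsto (fun x => scaledRising n x ^ ((1 : ℝ) / n)) (𝓝[≠] 0) (𝓝 1) := by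
    have h := (hf.continuousAt.rpow_const (p := (1 : ℝ) / n) (Or.inl (by simp [hf0]))).tendsto
    rw [hf0, Real.one_rpow] at h
    exact h.mono_left nhdsWithin_le_nhds
  have hinv : Tendsto (fun K : ℕ => (K : ℝ)⁻¹) atTop (𝓝[≠] 0) :=
    (tendsto_inv_atTop_nhdsGT_zero.comp tendsto_natCast_atTop_atTop).mono_right
      (nhdsWithin_mono _ fun _ hx => ne_of_gt hx)
  have hlim := (hgap.tendsto_slope_zero.div hroot one_ne_zero).comp hinv
  rw [div_one] at hlim
  refine hlim.congr' ?_
  filter_upwards [eventually_ge_atTop 1] with K hK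
  have hK1 : (1 : ℝ) ≤ K := by exact_mod_cast hK
  have hK0 : (K : ℝ) ≠ 0 := by positivity
  have h1 := prod_add_factorial_rpow hn0 hK1 1
  have h2 := prod_add_factorial_rpow hn0 hK1 2
  rw [Nat.cast_one, pow_one] at h1
  rw [Nat.cast_ofNat] at h2
  rw [h1, h2]
  simp only [Function.comp_apply, Pi.div_apply, zero_add, hf0, Real.one_rpow, mul_zero, add_zero,
    sub_self, sub_zero, inv_inv, smul_eq_mul]
  rw [← mul_div_mul_left _ (scaledRising n (K : ℝ)⁻¹ ^ ((1 : ℝ) / n)) hK0]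
  congr 1
  field_simp
  ring
end

section
/- For every integer n ≥ 7 there exists a real number K_n ≥ 1 such that the real function Θ_n(K) = (K(K+n-1) − Υ(K)^{2/n}) / Υ(K)^{1/n}, where Υ(K) = (K−1)K(K+1)⋯(K+n-2) + n!, is strictly increasing on the interval [K_n, ∞) (its derivative is strictly positive there). -/
open Finset in
/-- The normalized deviation `Θ_n(K)` of the distinct Dirichlet eigenvalue `K(K+n-1)` of
`S^n_+` from the Pólya bound at the lowest order of its chain, as a function of a real
variable `K`, with `Υ(K) = (K−1)^{\overline{n}} + n!`. -/
noncomputable def thetaFun (n : ℕ) : ℝ → ℝ := fun K =>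
  (K * (K + n - 1) - ((∏ i ∈ range n, (K - 1 + i)) + n.factorial) ^ ((2 : ℝ) / n))
    / ((∏ i ∈ range n, (K - 1 + i)) + n.factorial) ^ ((1 : ℝ) / n)

section

open Finset Filter

/-- Sum of the squares of `n` consecutive reals starting at `-c`. -/
lemma sum_range_sub_sq (n : ℕ) (c : ℝ) :
    ∑ i ∈ range n, ((i : ℝ) - c) ^ 2
      = n * (n - 1) * (2 * n - 1) / 6 - c * n * (n - 1) + n * c ^ 2 := by
  induction n with
  | zero => simp
  | succ k ih => rw [sum_range_succ, ih]; push_cast; ring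

/-- The variance-type sum of the centred arithmetic progression. -/
lemma sum_range_centered_sq (n : ℕ) :
    ∑ i ∈ range n, ((i : ℝ) - (n - 1) / 2) ^ 2 = n * (((n : ℝ) ^ 2 - 1) / 12) := by
  rw [sum_range_sub_sq]; ring

/-- The centred arithmetic progression is antisymmetric under reflection. -/
lemma centered_reflect {n i : ℕ} (hi : i ∈ range n) :
    (((n - 1 - i : ℕ) : ℝ) - (n - 1) / 2) = -((i : ℝ) - (n - 1) / 2) := by
  have h : i < n := mem_range.mp hi
  have h1 : i ≤ n - 1 := by omega
  rw [Nat.cast_sub h1, Nat.cast_sub (by omega : 1 ≤ n)]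
  push_cast; ring

lemma abs_centered_le {n i : ℕ} (hi : i ∈ range n) :
    |(i : ℝ) - (n - 1) / 2| ≤ n / 2 := by
  have h : (i : ℝ) + 1 ≤ n := by exact_mod_cast mem_range.mp hi
  have h0 : (0 : ℝ) ≤ i := Nat.cast_nonneg i
  rw [abs_le]; constructor <;> linarith

/-- AM-GM for a product of consecutive factors, centred at `x`. -/
lemma prod_centered_rpow_le {n : ℕ} (hn : 0 < n) {x : ℝ} (hx : (n : ℝ) ≤ x) :
    (∏ i ∈ range n, (x + ((i : ℝ) - (n - 1) / 2))) ^ ((2 : ℝ) / n)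
      ≤ x ^ 2 - ((n : ℝ) ^ 2 - 1) / 12 := by
  have hn' : (0 : ℝ) < n := by exact_mod_cast hn
  have hpos : ∀ i ∈ range n, 0 < x + ((i : ℝ) - (n - 1) / 2) := fun i hi => by
    have := abs_le.mp (abs_centered_le hi); linarith
  have hpos' : ∀ i ∈ range n, 0 ≤ x ^ 2 - ((i : ℝ) - (n - 1) / 2) ^ 2 := fun i hi => by
    have := abs_le.mp (abs_centered_le hi); nlinarith
  have hrefl : ∏ i ∈ range n, (x + ((i : ℝ) - (n - 1) / 2))
      = ∏ i ∈ range n, (x - ((i : ℝ) - (n - 1) / 2)) := by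
    rw [← prod_range_reflect]
    exact prod_congr rfl fun i hi => by rw [centered_reflect hi, ← sub_eq_add_neg]
  have hsq : (∏ i ∈ range n, (x + ((i : ℝ) - (n - 1) / 2))) ^ 2
      = ∏ i ∈ range n, (x ^ 2 - ((i : ℝ) - (n - 1) / 2) ^ 2) := by
    rw [sq]; nth_rewrite 2 [hrefl]
    rw [← prod_mul_distrib]
    exact prod_congr rfl fun i _ => by ring
  have amgm := Real.geom_mean_le_arith_mean (range n) (fun _ => (1 : ℝ))
    (fun i => x ^ 2 - ((i : ℝ) - (n - 1) / 2) ^ 2) (fun _ _ => zero_le_one)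
    (by simpa using hn') hpos'
  simp only [Real.rpow_one, one_mul, sum_const, card_range, nsmul_eq_mul, mul_one,
    sum_sub_distrib, sum_range_centered_sq] at amgm
  rw [show (2 : ℝ) / n = (2 : ℕ) * (n : ℝ)⁻¹ by push_cast; ring, Real.rpow_mul
    (prod_nonneg fun i hi => (hpos i hi).le), Real.rpow_natCast, hsq]
  refine amgm.trans (le_of_eq ?_)
  field_simp

/-- Second-order upper bound for a centred sum of reciprocals. -/
lemma sum_inv_centered_le {n : ℕ} (hn : 0 < n) {x : ℝ} (hx : (n : ℝ) ≤ x) :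
    ∑ i ∈ range n, (x + ((i : ℝ) - (n - 1) / 2))⁻¹
      ≤ n * ((1 + ((n : ℝ) ^ 2 - 1) / 12 / x ^ 2 + (n : ℝ) ^ 4 / x ^ 4) / x) := by
  have hn' : (0 : ℝ) < n := by exact_mod_cast hn
  have hx0 : 0 < x := hn'.trans_le hx
  have hrefl : ∑ i ∈ range n, (x + ((i : ℝ) - (n - 1) / 2))⁻¹
      = ∑ i ∈ range n, (x - ((i : ℝ) - (n - 1) / 2))⁻¹ := by
    rw [← sum_range_reflect]
    exact sum_congr rfl fun i hi => by rw [centered_reflect hi, ← sub_eq_add_neg]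
  have hterm : ∀ i ∈ range n,
      (x + ((i : ℝ) - (n - 1) / 2))⁻¹ + (x - ((i : ℝ) - (n - 1) / 2))⁻¹
        ≤ 2 / x * (1 + ((i : ℝ) - (n - 1) / 2) ^ 2 / x ^ 2 + (n : ℝ) ^ 4 / x ^ 4) := by
    intro i hi
    have habs := abs_centered_le hi
    generalize (i : ℝ) - (n - 1) / 2 = a at habs
    obtain ⟨h1, h2⟩ := abs_le.mp habs
    have ha : a ^ 2 ≤ (n : ℝ) ^ 2 / 4 := by nlinarith
    have ha4 : a ^ 4 ≤ (n : ℝ) ^ 4 / 16 := by nlinarith [sq_nonneg a]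
    have hax : a ^ 2 ≤ x ^ 2 / 4 := by nlinarith
    have e : (x + a)⁻¹ + (x - a)⁻¹ = 2 / x * (x ^ 2 / (x ^ 2 - a ^ 2)) := by
      have : x + a ≠ 0 := by linarith
      have : x - a ≠ 0 := by linarith
      rw [show x ^ 2 - a ^ 2 = (x + a) * (x - a) by ring]
      field_simp; ring
    rw [e]
    refine mul_le_mul_of_nonneg_left ?_ (by positivity)
    have hd : 0 < x ^ 2 - a ^ 2 := by nlinarith [sq_pos_of_pos hx0]
    have hquot : x ^ 2 / (x ^ 2 - a ^ 2) ≤ 1 + a ^ 2 / x ^ 2 + 2 * a ^ 4 / x ^ 4 := by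
      rw [div_le_iff₀ hd, ← sub_nonneg]
      have : (1 + a ^ 2 / x ^ 2 + 2 * a ^ 4 / x ^ 4) * (x ^ 2 - a ^ 2) - x ^ 2
          = a ^ 4 / x ^ 4 * (x ^ 2 - 2 * a ^ 2) := by field_simp; ring
      rw [this]
      exact mul_nonneg (by positivity) (by nlinarith [sq_nonneg x])
    have : 2 * a ^ 4 / x ^ 4 ≤ (n : ℝ) ^ 4 / x ^ 4 := by
      gcongr; nlinarith [pow_pos hn' 4]
    linarith
  have h2 : 2 * ∑ i ∈ range n, (x + ((i : ℝ) - (n - 1) / 2))⁻¹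
      ≤ 2 / x * (n + n * (((n : ℝ) ^ 2 - 1) / 12) / x ^ 2 + n * ((n : ℝ) ^ 4 / x ^ 4)) := by
    rw [two_mul]; nth_rewrite 2 [hrefl]
    rw [← sum_add_distrib]
    refine (sum_le_sum hterm).trans (le_of_eq ?_)
    rw [← mul_sum, sum_add_distrib, sum_add_distrib, ← sum_div, sum_range_centered_sq]
    simp
  have : 2 / x * (n + n * (((n : ℝ) ^ 2 - 1) / 12) / x ^ 2 + n * ((n : ℝ) ^ 4 / x ^ 4))
      = 2 * (n * ((1 + ((n : ℝ) ^ 2 - 1) / 12 / x ^ 2 + (n : ℝ) ^ 4 / x ^ 4) / x)) := by ring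
  linarith

/-- If `(1 + v/x² + m/x⁴)/x` is multiplied by `2x² + 2x - b` with `2v < b`, the result is
eventually smaller than `2x + 2`. -/
lemma eventually_mul_lt {v b : ℝ} (m : ℝ) (h : 2 * v < b) :
    ∀ᶠ x : ℝ in atTop,
      (2 * x ^ 2 + 2 * x - b) * ((1 + v / x ^ 2 + m / x ^ 4) / x) < 2 * x + 2 := by
  have hc : Continuous fun y : ℝ =>
      2 * v - b + 2 * v * y - v * b * y ^ 2 + m * y ^ 2 * (2 + 2 * y - b * y ^ 2) := by
    fun_prop
  have h0 := (hc.tendsto 0).comp tendsto_inv_atTop_zero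
  have h1 := h0.eventually (gt_mem_nhds (show _ < (0 : ℝ) by simpa using h))
  filter_upwards [h1, eventually_gt_atTop 0] with x hx hx0
  simp only [Function.comp] at hx
  rw [← sub_neg]
  have e : (2 * x ^ 2 + 2 * x - b) * ((1 + v / x ^ 2 + m / x ^ 4) / x) - (2 * x + 2)
      = x⁻¹ * (2 * v - b + 2 * v * x⁻¹ - v * b * x⁻¹ ^ 2
        + m * x⁻¹ ^ 2 * (2 + 2 * x⁻¹ - b * x⁻¹ ^ 2)) := by
    field_simp; ring
  rw [e]
  exact mul_neg_of_pos_of_neg (inv_pos.mpr hx0) hx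

/-- Logarithmic form of the derivative of a product of translates. -/
lemma hasDerivAt_prod_add {ι : Type*} (s : Finset ι) (a : ι → ℝ) {K : ℝ}
    (h : ∀ i ∈ s, K + a i ≠ 0) :
    HasDerivAt (fun K => ∏ i ∈ s, (K + a i))
      ((∏ i ∈ s, (K + a i)) * ∑ i ∈ s, (K + a i)⁻¹) K := by
  classical
  have := HasDerivAt.fun_finsetProd (u := s) (f := fun i K => K + a i) (f' := fun _ => 1)
    (x := K) (fun i _ => (hasDerivAt_id K).add_const (a i))
  refine this.congr_deriv ?_
  rw [mul_sum]
  refine sum_congr rfl fun i hi => ?_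
  rw [← mul_prod_erase s _ hi]
  have := h i hi
  simp only [smul_eq_mul, mul_one]
  field_simp

/-- A criterion for the positivity of the derivative of `(q - f^{2/ν}) / f^{1/ν}`. -/
lemma deriv_normalized_deviation_pos {q f : ℝ → ℝ} {q' f' ν K : ℝ}
    (hq : HasDerivAt q q' K) (hf : HasDerivAt f f' K) (hpos : 0 < f K)
    (h : (q K + f K ^ (2 / ν)) * (f' / (ν * f K)) < q') :
    0 < deriv (fun K => (q K - f K ^ (2 / ν)) / f K ^ (1 / ν)) K := by
  have hs : 0 < f K ^ (1 / ν) := Real.rpow_pos_of_pos hpos _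
  have hd := (hq.sub (hf.rpow_const (p := 2 / ν) (Or.inl hpos.ne'))).div
    (hf.rpow_const (p := 1 / ν) (Or.inl hpos.ne')) hs.ne'
  have e2 : f K ^ (2 / ν) = (f K ^ (1 / ν)) ^ 2 := by
    rw [← Real.rpow_natCast, ← Real.rpow_mul hpos.le]; congr 1; push_cast; ring
  refine lt_of_lt_of_eq ?_ hd.deriv.symm
  refine div_pos ?_ (pow_pos hs 2)
  simp only [Pi.sub_apply]
  rw [Real.rpow_sub_one hpos.ne', Real.rpow_sub_one hpos.ne', e2]
  rw [e2] at h
  set s := f K ^ (1 / ν)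
  have : (q' - f' * (2 / ν) * (s ^ 2 / f K)) * s - (q K - s ^ 2) * (f' * (1 / ν) * (s / f K))
      = s * (q' - (q K + s ^ 2) * (f' / (ν * f K))) := by ring
  rw [this]
  exact mul_pos hs (sub_pos.mpr h)

/-- Adding a nonnegative constant to `P` in `P^{2/ν} / P` decreases it when `ν ≥ 2`. -/
lemma add_rpow_two_div_mul_le {P c q S ν : ℝ} (hP : 0 < P) (hc : 0 ≤ c) (hq : 0 ≤ q)
    (hS : 0 ≤ S) (hν : 2 ≤ ν) :
    (q + (P + c) ^ (2 / ν)) * (P * S / (ν * (P + c))) ≤ (q + P ^ (2 / ν)) * (S / ν) := by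
  have hPc : 0 < P + c := by linarith
  have hν0 : 0 < ν := by linarith
  have hexp : 2 / ν - 1 ≤ 0 := by
    rw [sub_nonpos, div_le_one hν0]; exact hν
  have h1 : (P + c) ^ (2 / ν) / (P + c) ≤ P ^ (2 / ν) / P := by
    rw [← Real.rpow_sub_one hPc.ne', ← Real.rpow_sub_one hP.ne']
    exact Real.rpow_le_rpow_of_nonpos hP (by linarith) hexp
  have h2 : (P + c) ^ (2 / ν) / (P + c) * P ≤ P ^ (2 / ν) := by
    rwa [← le_div_iff₀ hP]
  have h3 : q * (P / (P + c)) ≤ q :=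
    mul_le_of_le_one_right hq ((div_le_one hPc).mpr (by linarith))
  have e : (q + (P + c) ^ (2 / ν)) * (P * S / (ν * (P + c)))
      = (q * (P / (P + c)) + (P + c) ^ (2 / ν) / (P + c) * P) * (S / ν) := by
    field_simp
  rw [e]
  gcongr

lemma eventually_deriv_thetaFun_pos {n : ℕ} (hn : 4 < n) :
    ∀ᶠ K : ℝ in atTop, 0 < deriv (thetaFun n) K := by
  have hn' : (4 : ℝ) < n := by exact_mod_cast hn
  have hlt : 2 * (((n : ℝ) ^ 2 - 1) / 12)
      < ((n : ℝ) ^ 2 - 1) / 12 + ((n : ℝ) - 3) * (n + 1) / 4 := by nlinarith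
  have hev := (tendsto_atTop_add_const_right atTop (((n : ℝ) - 3) / 2) tendsto_id).eventually
    (eventually_mul_lt ((n : ℝ) ^ 4) hlt)
  filter_upwards [hev, eventually_ge_atTop (n : ℝ)] with K hK hKn
  simp only [id] at hK
  set x := K + ((n : ℝ) - 3) / 2 with hx
  have hxn : (n : ℝ) ≤ x := by rw [hx]; linarith
  have hshift : ∀ i : ℕ, K + (-1 + (i : ℝ)) = x + ((i : ℝ) - (n - 1) / 2) := fun i => by
    rw [hx]; ring
  have hposi : ∀ i : ℕ, 0 < K + (-1 + (i : ℝ)) := fun i => by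
    have : (0 : ℝ) ≤ i := Nat.cast_nonneg i
    linarith
  have hprod : ∀ K : ℝ, ∏ i ∈ range n, (K - 1 + (i : ℝ))
      = ∏ i ∈ range n, (K + (-1 + (i : ℝ))) :=
    fun K => prod_congr rfl fun i _ => by ring
  have hP : 0 < ∏ i ∈ range n, (K + (-1 + (i : ℝ))) := prod_pos fun i _ => hposi i
  have hS : 0 ≤ ∑ i ∈ range n, (K + (-1 + (i : ℝ)))⁻¹ :=
    sum_nonneg fun i _ => (inv_pos.mpr (hposi i)).le
  have hq : HasDerivAt (fun K : ℝ => K * (K + n - 1)) (2 * x + 2) K := by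
    have := (hasDerivAt_id K).mul (((hasDerivAt_id K).add_const (n : ℝ)).sub_const 1)
    refine this.congr_deriv ?_
    simp only [id, hx]; ring
  have hf := (hasDerivAt_prod_add (range n) (fun i => -1 + (i : ℝ))
    fun i _ => (hposi i).ne').add_const (n.factorial : ℝ)
  have hq0 : 0 ≤ K * (K + n - 1) := mul_nonneg (by linarith) (by linarith)
  have hpow : (∏ i ∈ range n, (K + (-1 + (i : ℝ)))) ^ ((2 : ℝ) / n)
      ≤ x ^ 2 - ((n : ℝ) ^ 2 - 1) / 12 := by
    simp only [hshift]; exact prod_centered_rpow_le (by omega) hxn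
  have hsum : (∑ i ∈ range n, (K + (-1 + (i : ℝ)))⁻¹) / n
      ≤ (1 + ((n : ℝ) ^ 2 - 1) / 12 / x ^ 2 + (n : ℝ) ^ 4 / x ^ 4) / x := by
    rw [div_le_iff₀' (by linarith)]
    simp only [hshift]; exact sum_inv_centered_le (by omega) hxn
  have hfun : thetaFun n = fun K : ℝ => (K * (K + n - 1)
      - ((∏ i ∈ range n, (K + (-1 + (i : ℝ)))) + n.factorial) ^ ((2 : ℝ) / n))
        / ((∏ i ∈ range n, (K + (-1 + (i : ℝ)))) + n.factorial) ^ ((1 : ℝ) / n) := by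
    funext K; simp only [thetaFun, hprod]
  rw [hfun]
  refine deriv_normalized_deviation_pos hq hf (by positivity) ?_
  refine (add_rpow_two_div_mul_le hP (Nat.cast_nonneg _) hq0 hS (by linarith)).trans_lt ?_
  refine lt_of_le_of_lt ?_ hK
  refine mul_le_mul ?_ hsum (div_nonneg hS (by linarith)) ?_
  · have : K * (K + n - 1) = x ^ 2 + 2 * x - ((n : ℝ) - 3) * (n + 1) / 4 := by rw [hx]; ring
    linarith
  · have h1 : K * (K + n - 1) = x ^ 2 + 2 * x - ((n : ℝ) - 3) * (n + 1) / 4 := by rw [hx]; ring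
    have h2 := (Real.rpow_nonneg hP.le ((2 : ℝ) / n)).trans hpow
    linarith

end

/-- For every `n ≥ 7` there is a real `K_n ≥ 1` such that `Θ_n` is strictly increasing
on `[K_n, ∞)`, with strictly positive derivative there. -/
theorem stmt12 (n : ℕ) (hn : 7 ≤ n) :
    ∃ Kn : ℝ, 1 ≤ Kn ∧ StrictMonoOn (thetaFun n) (Set.Ici Kn) ∧
      ∀ K : ℝ, Kn ≤ K → 0 < deriv (thetaFun n) K := by
  obtain ⟨K₀, hK₀⟩ := Filter.eventually_atTop.mp
    (eventually_deriv_thetaFun_pos (n := n) (by omega))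
  have hpos : ∀ K : ℝ, max 1 K₀ ≤ K → 0 < deriv (thetaFun n) K := fun K hK =>
    hK₀ K ((le_max_right _ _).trans hK)
  refine ⟨max 1 K₀, le_max_left _ _, ?_, hpos⟩
  refine strictMonoOn_of_deriv_pos (convex_Ici _) (fun K hK => ?_) fun K hK =>
    hpos K (interior_subset hK)
  exact (differentiableAt_of_deriv_ne_zero
    (hpos K hK).ne').continuousAt.continuousWithinAt
end

section
/- For every integer n ≥ 2, every integer K ≥ 1, and every positive integer k with n!·k ≤ K(K+1)(K+2)⋯(K+n-1), one has K(K+n-1) ≥ n·k^{2/n}, with equality when K = k = 1. (Consequently every Dirichlet eigenvalue λ_k of the hemisphere S^n_+ satisfies λ_k ≥ n·k^{2/n} = λ_1·k^{2/n}.) -/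
/-- Pairing the factors `i` and `m - i` of a rising factorial. -/
theorem sq_prod_range_add_eq (K m : ℕ) :
    (∏ i ∈ Finset.range (m + 1), (K + i)) ^ 2 =
      ∏ i ∈ Finset.range (m + 1), (K * (K + m) + i * (m - i)) := by
  rw [sq]
  nth_rw 2 [← Finset.prod_range_reflect]
  rw [← Finset.prod_mul_distrib]
  refine Finset.prod_congr rfl fun i hi => ?_
  obtain ⟨j, rfl⟩ := Nat.exists_eq_add_of_le (Nat.lt_succ_iff.mp (Finset.mem_range.mp hi))
  have h : i + j + 1 - 1 - i = j := by omega
  rw [h, Nat.add_sub_cancel_left]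
  ring

theorem pow_mul_sq_prod_range_add_le (K m : ℕ) (hK : 1 ≤ K) :
    (m + 1) ^ (m + 1) * (∏ i ∈ Finset.range (m + 1), (K + i)) ^ 2 ≤
      (K * (K + m)) ^ (m + 1) * (m + 1).factorial ^ 2 := by
  have hfac : (m + 1).factorial = ∏ i ∈ Finset.range (m + 1), (1 + i) := by
    simp only [← Finset.prod_range_add_one_eq_factorial, add_comm]
  have hpow (a : ℕ) : a ^ (m + 1) = ∏ _i ∈ Finset.range (m + 1), a := by simp
  rw [hfac, sq_prod_range_add_eq, sq_prod_range_add_eq, hpow, hpow,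
    ← Finset.prod_mul_distrib, ← Finset.prod_mul_distrib]
  refine Finset.prod_le_prod' fun i _ => ?_
  have hP : m + 1 ≤ K * (K + m) := by nlinarith
  generalize i * (m - i) = c
  nlinarith [Nat.mul_le_mul_right c hP]

/-- Single-term lower bound for Dirichlet eigenvalues of `S^n_+`: for `n ≥ 2`, `K ≥ 1`,
`k ≥ 1` with `n!·k ≤ K^{\overline{n}}`, one has `K(K+n-1) ≥ n·k^{2/n}`, with equality
when `K = k = 1`. -/
theorem stmt13 (n : ℕ) (hn : 2 ≤ n) :
    (∀ K k : ℕ, 1 ≤ K → 1 ≤ k →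
      n.factorial * k ≤ ∏ i ∈ Finset.range n, (K + i) →
      (n : ℝ) * (k : ℝ) ^ ((2 : ℝ) / n) ≤ (K : ℝ) * ((K : ℝ) + n - 1)) ∧
    (1 : ℝ) * ((1 : ℝ) + n - 1) = (n : ℝ) * (1 : ℝ) ^ ((2 : ℝ) / n) := by
  refine ⟨fun K k hK _ h => ?_, by simp⟩
  obtain ⟨m, rfl⟩ : ∃ m, n = m + 1 := ⟨n - 1, by omega⟩
  have key : (m + 1) ^ (m + 1) * k ^ 2 ≤ (K * (K + m)) ^ (m + 1) := by
    refine Nat.le_of_mul_le_mul_right (c := (m + 1).factorial ^ 2) ?_ (by positivity)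
    calc (m + 1) ^ (m + 1) * k ^ 2 * (m + 1).factorial ^ 2
        = (m + 1) ^ (m + 1) * ((m + 1).factorial * k) ^ 2 := by ring
      _ ≤ (m + 1) ^ (m + 1) * (∏ i ∈ Finset.range (m + 1), (K + i)) ^ 2 := by gcongr
      _ ≤ _ := pow_mul_sq_prod_range_add_le K m hK
  have hR : (K : ℝ) * ((K : ℝ) + (m + 1 : ℕ) - 1) = K * (K + m) := by push_cast; ring
  rw [hR]
  refine le_of_pow_le_pow_left₀ (Nat.succ_ne_zero m) (by positivity) ?_
  have hroot : ((k : ℝ) ^ ((2 : ℝ) / (m + 1 : ℕ))) ^ (m + 1) = (k : ℝ) ^ 2 := by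
    rw [← Real.rpow_mul_natCast (Nat.cast_nonneg k), div_mul_cancel₀ _ (by positivity)]
    exact Real.rpow_two _
  rw [mul_pow, hroot]
  exact_mod_cast key
end

section
/- For every integer n ≥ 2 and every integer K ≥ 1, setting Y = K(K+1)⋯(K+n-2)·(K + n/2 − 1), one has K(K+n-1) < Y^{2/n} + Y^{1/n} for n ≥ 3, with equality of the two sides only when K = 0 (for n = 2 the inequality is an equality, since Y = K·(K) · ... reduces appropriately; in all cases K(K+n-1) ≤ Y^{2/n} + Y^{1/n}). -/
/-- The square of a rising factorial is at least the power of the product of its extreme factors. -/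
theorem pow_le_sq_prod_range_add (x : ℝ) (hx : 0 ≤ x) (m : ℕ) :
    (x * (x + m)) ^ (m + 1) ≤ (∏ i ∈ Finset.range (m + 1), (x + (i : ℝ))) ^ 2 := by
  have hreflect := Finset.prod_range_reflect (fun i : ℕ => x + (i : ℝ)) (m + 1)
  rw [sq]
  nth_rewrite 1 [← hreflect]
  rw [← Finset.prod_mul_distrib]
  have hconst : (x * (x + m)) ^ (m + 1) = ∏ _i ∈ Finset.range (m + 1), x * (x + (m : ℝ)) := by
    simp
  rw [hconst]
  refine Finset.prod_le_prod (fun i _ => by positivity) fun i hi => ?_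
  have him : i ≤ m := Nat.lt_succ_iff.mp (Finset.mem_range.mp hi)
  have him' : (i : ℝ) ≤ m := by exact_mod_cast him
  have hi0 : (0 : ℝ) ≤ i := Nat.cast_nonneg i
  rw [Nat.add_sub_cancel, Nat.cast_sub him]
  nlinarith [mul_nonneg hi0 (sub_nonneg.mpr him')]

/-- The rising factorial times the mean of its factors dominates a power of the geometric mean
of its extreme factors. -/
theorem pow_le_sq_prod_range_add_mul (x : ℝ) (hx : 0 ≤ x) (m : ℕ) :
    (x * (x + m)) ^ (m + 2) ≤
      ((∏ i ∈ Finset.range (m + 1), (x + (i : ℝ))) * (x + m / 2)) ^ 2 := by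
  rw [pow_succ (x * (x + m)) (m + 1), mul_pow _ (x + (m : ℝ) / 2)]
  refine mul_le_mul (pow_le_sq_prod_range_add x hx m) ?_ (by positivity) (by positivity)
  nlinarith [sq_nonneg (m : ℝ)]


/-- Upper bound for closed eigenvalues of `S^n`: for `n ≥ 2` and an integer `K ≥ 1`, with
`Y = K^{\overline{n-1}}·(K + n/2 − 1)`, one has `K(K+n-1) ≤ Y^{2/n} + Y^{1/n}`; the
inequality is strict for `n ≥ 3`, and is an equality for `n = 2`. -/
theorem stmt15 (n : ℕ) (hn : 2 ≤ n) (K : ℕ) (hK : 1 ≤ K) :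
    ((K : ℝ) * ((K : ℝ) + n - 1) ≤
      ((∏ i ∈ Finset.range (n - 1), ((K : ℝ) + i)) * ((K : ℝ) + n / 2 - 1))
          ^ ((2 : ℝ) / n)
        + ((∏ i ∈ Finset.range (n - 1), ((K : ℝ) + i)) * ((K : ℝ) + n / 2 - 1))
            ^ ((1 : ℝ) / n)) ∧
    (3 ≤ n →
      (K : ℝ) * ((K : ℝ) + n - 1) <
        ((∏ i ∈ Finset.range (n - 1), ((K : ℝ) + i)) * ((K : ℝ) + n / 2 - 1))
            ^ ((2 : ℝ) / n)
          + ((∏ i ∈ Finset.range (n - 1), ((K : ℝ) + i)) * ((K : ℝ) + n / 2 - 1))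
              ^ ((1 : ℝ) / n)) ∧
    (n = 2 →
      (K : ℝ) * ((K : ℝ) + n - 1) =
        ((∏ i ∈ Finset.range (n - 1), ((K : ℝ) + i)) * ((K : ℝ) + n / 2 - 1))
            ^ ((2 : ℝ) / n)
          + ((∏ i ∈ Finset.range (n - 1), ((K : ℝ) + i)) * ((K : ℝ) + n / 2 - 1))
              ^ ((1 : ℝ) / n)) := by
  obtain ⟨m, rfl⟩ : ∃ m, n = m + 2 := ⟨n - 2, by omega⟩
  have hK1 : (1 : ℝ) ≤ K := by exact_mod_cast hK
  have hY := pow_le_sq_prod_range_add_mul (K : ℝ) (by positivity) m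
  have hmean : (K : ℝ) + ((m + 2 : ℕ) : ℝ) / 2 - 1 = K + m / 2 := by push_cast; ring
  have hlast : (K : ℝ) + ((m + 2 : ℕ) : ℝ) - 1 = K + m + 1 := by push_cast; ring
  rw [hmean, hlast, show m + 2 - 1 = m + 1 from rfl]
  have hY0 : 0 ≤ (∏ i ∈ Finset.range (m + 1), ((K : ℝ) + i)) * ((K : ℝ) + m / 2) := by
    positivity
  have htwo : m + 2 = 2 → (∏ i ∈ Finset.range (m + 1), ((K : ℝ) + i)) * ((K : ℝ) + m / 2)
      = (K : ℝ) ^ (m + 2) := by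
    intro h
    obtain rfl : m = 0 := by omega
    simp [sq]
  generalize (∏ i ∈ Finset.range (m + 1), ((K : ℝ) + i)) * ((K : ℝ) + m / 2) = Y at *
  have hZ0 : 0 ≤ Y ^ ((1 : ℝ) / (m + 2 : ℕ)) := Real.rpow_nonneg hY0 _
  have hZsq : Y ^ ((2 : ℝ) / (m + 2 : ℕ)) = (Y ^ ((1 : ℝ) / (m + 2 : ℕ))) ^ 2 := by
    rw [← Real.rpow_mul_natCast hY0]
    congr 1
    push_cast
    ring
  have hZpow : (Y ^ ((1 : ℝ) / (m + 2 : ℕ))) ^ (m + 2) = Y := by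
    rw [one_div]
    exact Real.rpow_inv_natCast_pow hY0 (by omega)
  rw [hZsq]
  generalize Y ^ ((1 : ℝ) / (m + 2 : ℕ)) = Z at *
  have hP : (K : ℝ) * (K + m) ≤ Z ^ 2 := by
    rw [← hZpow, ← pow_mul, mul_comm (m + 2) 2, pow_mul] at hY
    exact le_of_pow_le_pow_left₀ (by omega) (by positivity) hY
  have hm0 : (0 : ℝ) ≤ m := Nat.cast_nonneg m
  refine ⟨?_, fun h => ?_, fun h => ?_⟩
  · have hKZ : (K : ℝ) ≤ Z := by nlinarith
    nlinarith
  · have hm1 : (1 : ℝ) ≤ m := by exact_mod_cast (by omega : 1 ≤ m)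
    have hKZ : (K : ℝ) < Z := by nlinarith
    nlinarith
  · have hZK : Z = K :=
      (pow_left_inj₀ hZ0 (by positivity) (by omega)).mp (hZpow.trans (htwo h))
    obtain rfl : m = 0 := by omega
    rw [hZK]
    push_cast
    ring
end

section
/- (a) For every integer K ≥ 0, the sum over k from K² to (K+1)² − 1 of (K(K+1) − k) equals 0. (b) For every integer n ≥ 3 there exists K_n ≥ 1 such that for all integers K ≥ K_n, the sum over j from 0 to m(K)−1 of (K(K+n-1) − (n!/2)^{2/n}·(σ(K−1) + j)^{2/n}) is strictly negative, where m(K) = (K+1)(K+2)⋯(K+n-1)·(2K+n-1)/((n-1)!·(K+n-1)) and σ(K) = (K+1)(K+2)⋯(K+n-1)·(n+2K)/n!. -/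
/-- The sum of the first `N` terms of an arithmetic progression. -/
lemma sum_range_add_mul (a b : ℝ) (N : ℕ) :
    ∑ j ∈ Finset.range N, (a + b * (j : ℝ)) = N * a + b * (N * (N - 1) / 2) := by
  induction N with
  | zero => simp
  | succ N ih => rw [Finset.sum_range_succ, ih]; push_cast; ring

/-- The cumulative multiplicity `σ(K - 1)` on the sphere `S^(q+2)`, as a function of a real `K`. -/
noncomputable def sphereCumMult (q : ℕ) (x : ℝ) : ℝ :=
  (∏ i ∈ Finset.range (q + 1), (x + i)) * (((q + 2 : ℕ) : ℝ) + 2 * x - 2) / ((q + 2).factorial : ℝ)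

lemma sphereCumMult_nonneg (q : ℕ) {x : ℝ} (hx : 0 ≤ x) : 0 ≤ sphereCumMult q x := by
  have h : (0 : ℝ) ≤ ((q + 2 : ℕ) : ℝ) + 2 * x - 2 := by push_cast; linarith [q.cast_nonneg (α := ℝ)]
  unfold sphereCumMult
  have : 0 ≤ ∏ i ∈ Finset.range (q + 1), (x + (i : ℝ)) :=
    Finset.prod_nonneg fun i _ => by positivity
  positivity

lemma cast_choose_mul_factorial (L n : ℕ) :
    ((L + n).choose n : ℝ) * (n.factorial : ℝ) = ∏ i ∈ Finset.range n, ((L : ℝ) + 1 + i) := by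
  have h := Nat.ascFactorial_eq_factorial_mul_choose L n
  have h' : (((L + 1).ascFactorial n : ℕ) : ℝ) = ∏ i ∈ Finset.range n, ((L : ℝ) + 1 + i) := by
    rw [Nat.ascFactorial_eq_prod_range]; push_cast; rfl
  rw [← h', h]; push_cast; ring

lemma sphereCumMult_natCast_add_one (q L : ℕ) :
    sphereCumMult q ((L : ℝ) + 1)
      = ((L + (q + 2)).choose (q + 2) : ℝ) + ((L + (q + 1)).choose (q + 2) : ℝ) := by
  have hf : ((q + 2).factorial : ℝ) ≠ 0 := by positivity
  have h1 := cast_choose_mul_factorial L (q + 2)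
  have h2 : ((L + (q + 1)).choose (q + 2) : ℝ) * ((q + 2).factorial : ℝ)
      = L * ∏ i ∈ Finset.range (q + 1), ((L : ℝ) + 1 + i) := by
    cases L with
    | zero => simp
    | succ M =>
      have h := cast_choose_mul_factorial M (q + 2)
      rw [show M + 1 + (q + 1) = M + (q + 2) by ring, h, Finset.prod_range_succ', mul_comm]
      push_cast
      rw [add_zero]
      congr 1
      exact Finset.prod_congr rfl fun i _ => by ring
  rw [Finset.prod_range_succ] at h1
  rw [sphereCumMult, div_eq_iff hf, add_mul, h1, h2]
  push_cast
  ring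

/-- Pairing the factors of the rising factorial symmetrically bounds its square from below. -/
lemma mul_pow_le_sq_prod_range (q : ℕ) {x : ℝ} (hx : 0 ≤ x) :
    (x * (x + q)) ^ (q + 1) ≤ (∏ i ∈ Finset.range (q + 1), (x + i)) ^ 2 := by
  have h : (∏ i ∈ Finset.range (q + 1), (x + (i : ℝ))) ^ 2
      = ∏ i ∈ Finset.range (q + 1), (x + (i : ℝ)) * (x + ((q - i : ℕ) : ℝ)) := by
    rw [Finset.prod_mul_distrib, sq]
    congr 1
    rw [← Finset.prod_range_reflect]
    exact Finset.prod_congr rfl fun i _ => by simp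
  rw [h, Finset.pow_eq_prod_const]
  refine Finset.prod_le_prod (fun i _ => by positivity) fun i hi => ?_
  have hi' : i ≤ q := Nat.lt_succ_iff.mp (Finset.mem_range.mp hi)
  rw [Nat.cast_sub hi']
  have h1 : (i : ℝ) ≤ q := by exact_mod_cast hi'
  nlinarith [mul_nonneg i.cast_nonneg (sub_nonneg.mpr h1)]

lemma mul_le_weyl_mul_sphereCumMult_rpow (q : ℕ) {x : ℝ} (hx : 0 ≤ x) :
    x * (x + q) ≤ (((q + 2).factorial : ℝ) / 2) ^ ((2 : ℝ) / ((q + 2 : ℕ) : ℝ))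
      * sphereCumMult q x ^ ((2 : ℝ) / ((q + 2 : ℕ) : ℝ)) := by
  have hs := sphereCumMult_nonneg q hx
  have hf : ((q + 2).factorial : ℝ) ≠ 0 := by positivity
  have hc : ((q + 2).factorial : ℝ) / 2 * sphereCumMult q x
      = (∏ i ∈ Finset.range (q + 1), (x + (i : ℝ))) * (x + q / 2) := by
    unfold sphereCumMult; push_cast; field_simp; ring
  have hx' : 0 ≤ x * (x + q) := by positivity
  rw [← Real.mul_rpow (by positivity) hs, hc]
  have hP : 0 ≤ (∏ i ∈ Finset.range (q + 1), (x + (i : ℝ))) * (x + q / 2) := by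
    rw [← hc]; positivity
  have key : (x * (x + q)) ^ (q + 2)
      ≤ ((∏ i ∈ Finset.range (q + 1), (x + (i : ℝ))) * (x + q / 2)) ^ 2 := by
    rw [mul_pow _ (x + (q : ℝ) / 2), pow_succ]
    exact mul_le_mul (mul_pow_le_sq_prod_range q hx) (by nlinarith [sq_nonneg (q : ℝ)]) hx'
      (by positivity)
  rw [div_eq_mul_inv (2 : ℝ), Real.rpow_mul hP, Real.rpow_two]
  calc x * (x + q) = ((x * (x + q)) ^ (q + 2)) ^ (((q + 2 : ℕ) : ℝ)⁻¹) :=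
        (Real.pow_rpow_inv_natCast hx' (by omega)).symm
    _ ≤ _ := Real.rpow_le_rpow (by positivity) key (by positivity)

/-- A concave power lies above its chord on `[s, s + m]`. -/
lemma chord_le_rpow {s m j p : ℝ} (hs : 0 ≤ s) (hm : 0 < m) (hj : 0 ≤ j) (hjm : j ≤ m)
    (hp0 : 0 ≤ p) (hp1 : p ≤ 1) :
    (1 - j / m) * s ^ p + j / m * (s + m) ^ p ≤ (s + j) ^ p := by
  have hsm : s + m ∈ Set.Ici (0 : ℝ) := Set.mem_Ici.mpr (by positivity)
  have h := (Real.concaveOn_rpow hp0 hp1).2 (Set.mem_Ici.mpr hs) hsm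
    (sub_nonneg.mpr ((div_le_one hm).mpr hjm)) (by positivity : 0 ≤ j / m) (by ring)
  simp only [smul_eq_mul] at h
  have e : (1 - j / m) * s + j / m * (s + m) = s + j := by
    field_simp
    ring
  rwa [e] at h

lemma choose_le_sphere_mult (q L : ℕ) (hq : 1 ≤ q) :
    (L + 3).choose 2 + (q + 1 + L).choose (q + 2) ≤ (q + 2 + (L + 1)).choose (q + 2) := by
  have h1 : (q + 2 + (L + 1)).choose (q + 2)
      = (q + 2 + L).choose (q + 1) + (q + 2 + L).choose (q + 2) :=
    Nat.choose_succ_succ (q + 2 + L) (q + 1)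
  have h2 : (L + 3).choose 2 ≤ (q + 2 + L).choose (q + 1) := by
    rw [← Nat.choose_symm_of_eq_add (show L + 3 = (L + 1) + 2 by ring),
      Nat.choose_symm_of_eq_add (show q + 2 + L = (q + 1) + (L + 1) by ring)]
    exact Nat.choose_le_choose _ (by omega)
  have h3 : (q + 1 + L).choose (q + 2) ≤ (q + 2 + L).choose (q + 2) :=
    Nat.choose_le_choose _ (by omega)
  omega


/-- Averages over chains on spheres. (a) On `S²`, for every `K ≥ 0`,
`∑_{k=K²}^{(K+1)²−1} (K(K+1) − k) = 0`. (b) On `S^n` with `n ≥ 3`, there is `K_n ≥ 1`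
such that for all `K ≥ K_n`,
`∑_{j=0}^{m(K)−1} (K(K+n-1) − (n!/2)^{2/n} (σ(K−1)+j)^{2/n}) < 0`, where
`m(K) = binom(n+K, n) − binom(n+K−2, n)` and
`σ(K−1) = K^{\overline{n-1}}(n+2K−2)/n!`. -/
theorem stmt19 :
    (∀ K : ℕ,
      ∑ k ∈ Finset.Icc (K ^ 2) ((K + 1) ^ 2 - 1),
        ((K : ℝ) * ((K : ℝ) + 1) - (k : ℝ)) = 0) ∧
    (∀ n : ℕ, 3 ≤ n → ∃ Kn : ℕ, 1 ≤ Kn ∧ ∀ K : ℕ, Kn ≤ K →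
      ∑ j ∈ Finset.range ((n + K).choose n - (n + K - 2).choose n),
        ((K : ℝ) * ((K : ℝ) + n - 1)
          - ((n.factorial : ℝ) / 2) ^ ((2 : ℝ) / n)
            * ((∏ i ∈ Finset.range (n - 1), ((K : ℝ) + i))
                * ((n : ℝ) + 2 * K - 2) / (n.factorial : ℝ)
              + (j : ℝ)) ^ ((2 : ℝ) / n)) < 0) := by
  refine ⟨fun K => ?_, fun n hn => ⟨1, le_rfl, fun K hK => ?_⟩⟩
  · have hI : Finset.Icc (K ^ 2) ((K + 1) ^ 2 - 1) = Finset.Ico (K ^ 2) ((K + 1) ^ 2) := by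
      ext k
      have : 0 < (K + 1) ^ 2 := by positivity
      simp only [Finset.mem_Icc, Finset.mem_Ico]
      omega
    rw [hI, Finset.sum_Ico_eq_sum_range, show (K + 1) ^ 2 - K ^ 2 = 2 * K + 1 by
      rw [show (K + 1) ^ 2 = K ^ 2 + (2 * K + 1) by ring, Nat.add_sub_cancel_left]]
    rw [Finset.sum_congr rfl fun j _ => show (K : ℝ) * ((K : ℝ) + 1) - ((K ^ 2 + j : ℕ) : ℝ)
      = (K : ℝ) + (-1) * (j : ℝ) by push_cast; ring, sum_range_add_mul]
    push_cast
    ring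
  · obtain ⟨q, rfl⟩ : ∃ q, n = q + 2 := ⟨n - 2, by omega⟩
    obtain ⟨L, rfl⟩ : ∃ L, K = L + 1 := ⟨K - 1, by omega⟩
    have hq : 1 ≤ q := by omega
    have hqR : (1 : ℝ) ≤ q := by exact_mod_cast hq
    rw [show q + 2 + (L + 1) - 2 = q + 1 + L by omega, show q + 2 - 1 = q + 1 by omega]
    have hch := choose_le_sphere_mult q L hq
    set m := (q + 2 + (L + 1)).choose (q + 2) - (q + 1 + L).choose (q + 2) with hm
    set x : ℝ := ((L + 1 : ℕ) : ℝ) with hx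
    have hxL : x = (L : ℝ) + 1 := by rw [hx]; push_cast; ring
    have hx1 : 1 ≤ x := by rw [hxL]; linarith [L.cast_nonneg (α := ℝ)]
    have hx0 : 0 ≤ x := by linarith
    have hmR : (x + 2) * (x + 1) / 2 ≤ (m : ℝ) := by
      have h : (((L + 3).choose 2 : ℕ) : ℝ) ≤ m := by exact_mod_cast (by omega)
      rw [Nat.cast_choose_two] at h
      push_cast at h
      rw [hxL]
      linarith
    have hm0 : (0 : ℝ) < m := lt_of_lt_of_le (by positivity) hmR
    have hsucc : sphereCumMult q x + m = sphereCumMult q (x + 1) := by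
      have h1 := sphereCumMult_natCast_add_one q (L + 1)
      rw [← hx] at h1
      have h2 : (m : ℝ) = ((q + 2 + (L + 1)).choose (q + 2) : ℝ)
          - ((q + 1 + L).choose (q + 2) : ℝ) := by
        rw [hm, Nat.cast_sub (by omega)]
      rw [h1, h2, hxL, sphereCumMult_natCast_add_one, add_comm (q + 2) (L + 1),
        add_comm (q + 1) L, show L + 1 + (q + 1) = L + (q + 2) by ring]
      ring
    have hterm : ∀ j ∈ Finset.range m,
        x * (x + ((q + 2 : ℕ) : ℝ) - 1)
          - (((q + 2).factorial : ℝ) / 2) ^ ((2 : ℝ) / ((q + 2 : ℕ) : ℝ))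
            * (sphereCumMult q x + (j : ℝ)) ^ ((2 : ℝ) / ((q + 2 : ℕ) : ℝ))
        ≤ x + (-((2 * x + 1 + q) / m)) * (j : ℝ) := by
      intro j hj
      have hjm : (j : ℝ) ≤ m := by exact_mod_cast (Finset.mem_range.mp hj).le
      have ht0 : (0 : ℝ) ≤ j / m := by positivity
      have ht1 : (j : ℝ) / m ≤ 1 := (div_le_one hm0).mpr hjm
      have hB1 := mul_le_weyl_mul_sphereCumMult_rpow q hx0
      have hB2 := mul_le_weyl_mul_sphereCumMult_rpow q (x := x + 1) (by positivity)
      have hp1 : (2 : ℝ) / ((q + 2 : ℕ) : ℝ) ≤ 1 := by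
        rw [div_le_one (by positivity)]; push_cast; linarith
      have hchord := chord_le_rpow (sphereCumMult_nonneg q hx0) hm0 j.cast_nonneg hjm
        (by positivity) hp1
      rw [hsucc] at hchord
      have hC : 0 ≤ (((q + 2).factorial : ℝ) / 2) ^ ((2 : ℝ) / ((q + 2 : ℕ) : ℝ)) := by
        positivity
      have e1 := mul_le_mul_of_nonneg_left hchord hC
      have e2 := mul_le_mul_of_nonneg_left hB1 (sub_nonneg.mpr ht1)
      have e3 := mul_le_mul_of_nonneg_left hB2 ht0
      have e4 : (2 * x + 1 + q) / m * (j : ℝ) = (2 * x + 1 + q) * (j / m) := by ring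
      rw [neg_mul, e4]
      push_cast at e1 e2 e3 ⊢
      linarith
    refine lt_of_le_of_lt (Finset.sum_le_sum hterm) ?_
    rw [sum_range_add_mul]
    have e : -((2 * x + 1 + q) / m) * ((m : ℝ) * (m - 1) / 2)
        = -((2 * x + 1 + q) * (m - 1) / 2) := by
      field_simp
    rw [e]
    nlinarith [mul_le_mul_of_nonneg_right hmR (by positivity : (0 : ℝ) ≤ q + 1),
      mul_nonneg (sub_nonneg.mpr hqR) hx0, mul_nonneg (mul_nonneg (sub_nonneg.mpr hqR) hx0) hx0]
end
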